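/- arXiv:2306.01882 — 6 statements merged into one kernel-verified Lean document; each statement's English description precedes it below -/
import Mathlib

section
/- The two expressions for the Eberlein polynomial coincide: for all natural numbers i, x, N, p with i ≤ p, x ≤ p and p + x ≤ N, one has Σ_{ℓ=0}^{i} (−1)^ℓ C(x,ℓ) C(p−x,i−ℓ) C(N−p−x,i−ℓ) = Σ_{ℓ=0}^{i} (−1)^{i+ℓ} C(p−ℓ,p−i) C(p−x,ℓ) C(N−p−x+ℓ,ℓ). -/
open Polynomial in
theorem Polynomial.coeff_one_sub_X_pow_eq (n k : ℕ) :
    ((1 - X : ℚ[X]) ^ n).coeff k = (-1) ^ k * (n.choose k : ℚ) := by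
  have h : (1 - X : ℚ[X]) ^ n = ((1 + X : ℚ[X]) ^ n).comp (-X) := by
    simp [sub_eq_add_neg]
  rw [h, ← neg_one_mul, ← C_1, ← C_neg, comp_C_mul_X_coeff, C_1,
    coeff_one_add_X_pow, mul_comm]

theorem Nat.choose_add_self_eq_sum (b l : ℕ) :
    (b + l).choose l = ∑ j ∈ Finset.range (l + 1), b.choose j * l.choose j := by
  rw [Nat.add_choose_eq, Finset.Nat.sum_antidiagonal_eq_sum_range_succ_mk]
  refine Finset.sum_congr rfl fun j hj => ?_
  rw [Nat.choose_symm (Finset.mem_range_succ_iff.1 hj)]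

/-- The binomial moments of the binomial distribution. -/
theorem sum_choose_mul_choose_mul_pow {R : Type*} [CommRing R] (t : R) (a j : ℕ) :
    ∑ l ∈ Finset.range (a + 1),
      (a.choose l : R) * (l.choose j : R) * t ^ l * (1 - t) ^ (a - l) = a.choose j * t ^ j := by
  rcases lt_or_ge a j with h | h
  · rw [Nat.choose_eq_zero_of_lt h, Nat.cast_zero, zero_mul]
    refine Finset.sum_eq_zero fun l hl => ?_
    rw [Nat.choose_eq_zero_of_lt (lt_of_le_of_lt (Finset.mem_range_succ_iff.1 hl) h)]
    simp
  · obtain ⟨m, rfl⟩ := Nat.exists_eq_add_of_le h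
    rw [add_assoc, Finset.sum_range_add, Finset.sum_eq_zero, zero_add]
    · have hb := add_pow t (1 - t) m
      rw [add_sub_cancel, one_pow] at hb
      refine Eq.trans ?_ ((congrArg (_ * t ^ j * ·) hb.symm).trans (mul_one _))
      rw [Finset.mul_sum]
      refine Finset.sum_congr rfl fun l hl => ?_
      have hc := Nat.choose_mul (n := j + m) (k := j + l) (s := j) (by omega)
      rw [Nat.add_sub_cancel_left, Nat.add_sub_cancel_left] at hc
      rw [← Nat.cast_mul, hc, Nat.add_sub_add_left]
      push_cast
      ring
    · intro l hl
      rw [Nat.choose_eq_zero_of_lt (Finset.mem_range.1 hl)]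
      simp

theorem sum_choose_mul_choose_mul_pow_eq {R : Type*} [CommRing R] (t : R) (a b : ℕ) :
    ∑ j ∈ Finset.range (a + 1), (a.choose j : R) * (b.choose j : R) * t ^ j =
      ∑ l ∈ Finset.range (a + 1),
        (a.choose l : R) * ((b + l).choose l : R) * t ^ l * (1 - t) ^ (a - l) := by
  have h : ∀ l ∈ Finset.range (a + 1),
      (a.choose l : R) * ((b + l).choose l : R) * t ^ l * (1 - t) ^ (a - l) =
        ∑ j ∈ Finset.range (a + 1), (b.choose j : R) *
          ((a.choose l : R) * (l.choose j : R) * t ^ l * (1 - t) ^ (a - l)) := by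
    intro l hl
    have hs : Finset.range (l + 1) ⊆ Finset.range (a + 1) :=
      Finset.range_subset_range.2 (by simpa using hl)
    rw [Nat.choose_add_self_eq_sum, Finset.sum_subset hs]
    · push_cast
      simp only [Finset.mul_sum, Finset.sum_mul]
      exact Finset.sum_congr rfl fun j _ => by ring
    · intro j _ hj
      rw [Nat.choose_eq_zero_of_lt (n := l) (by simpa using hj), mul_zero]
  rw [Finset.sum_congr rfl h, Finset.sum_comm]
  refine Finset.sum_congr rfl fun j _ => ?_
  rw [← Finset.mul_sum, sum_choose_mul_choose_mul_pow]
  ring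

/-- A sum whose terms vanish beyond both bounds does not depend on which bound is used. -/
theorem Finset.sum_range_succ_eq_of_eq_zero {M : Type*} [AddCommMonoid M] {f : ℕ → M} {a i : ℕ}
    (ha : ∀ l, a < l → f l = 0) (hi : ∀ l, i < l → f l = 0) :
    ∑ l ∈ Finset.range (a + 1), f l = ∑ l ∈ Finset.range (i + 1), f l := by
  rcases le_total a i with h | h
  · exact Finset.sum_subset (Finset.range_subset_range.2 (by omega))
      fun l _ hl => ha l (by simpa using hl)
  · exact (Finset.sum_subset (Finset.range_subset_range.2 (by omega))
      fun l _ hl => hi l (by simpa using hl)).symm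

open Polynomial in
theorem Polynomial.coeff_sum_mul_X_pow_mul (c : ℕ → ℚ) (q : ℕ → ℚ[X]) (a i : ℕ)
    (hc : ∀ l, a < l → c l = 0) :
    (∑ l ∈ Finset.range (a + 1), C (c l) * (q l * X ^ l)).coeff i =
      ∑ l ∈ Finset.range (i + 1), c l * (q l).coeff (i - l) := by
  simp only [finsetSum_coeff, coeff_C_mul, coeff_mul_X_pow']
  rw [Finset.sum_range_succ_eq_of_eq_zero (i := i)]
  · refine Finset.sum_congr rfl fun l hl => ?_
    rw [if_pos (Finset.mem_range_succ_iff.1 hl)]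
  · intro l hl
    rw [hc l hl, zero_mul]
  · intro l hl
    rw [if_neg (by omega), mul_zero]

/-- The two expressions for the Eberlein polynomial coincide. -/
theorem eberlein_two_forms (i x N p : ℕ) (hi : i ≤ p) (hx : x ≤ p) (hpx : p + x ≤ N) :
    (∑ l ∈ Finset.range (i + 1),
      (-1 : ℚ) ^ l * (Nat.choose x l) * (Nat.choose (p - x) (i - l)) *
        (Nat.choose (N - p - x) (i - l)))
  = ∑ l ∈ Finset.range (i + 1),
      (-1 : ℚ) ^ (i + l) * (Nat.choose (p - l) (p - i)) * (Nat.choose (p - x) l) *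
        (Nat.choose (N - p - x + l) l) := by
  obtain ⟨a, rfl⟩ := Nat.exists_eq_add_of_le' hx
  generalize N - (a + x) - x = b
  rw [Nat.add_sub_cancel]
  have key := congrArg (fun P => ((1 - Polynomial.X) ^ x * P).coeff i)
    (sum_choose_mul_choose_mul_pow_eq (Polynomial.X : Polynomial ℚ) a b)
  have hl := Polynomial.coeff_sum_mul_X_pow_mul (fun l => (a.choose l : ℚ) * b.choose l)
    (fun _ => (1 - Polynomial.X) ^ x) a i
    (fun l h => by simp [Nat.choose_eq_zero_of_lt h])
  have hr := Polynomial.coeff_sum_mul_X_pow_mul (fun l => (a.choose l : ℚ) * (b + l).choose l)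
    (fun l => (1 - Polynomial.X) ^ x * (1 - Polynomial.X) ^ (a - l)) a i
    (fun l h => by simp [Nat.choose_eq_zero_of_lt h])
  have hlr := hl.symm.trans ((Eq.trans ?_ (key.trans ?_)).trans hr)
  · rw [← Finset.sum_range_reflect] at hlr
    refine (Finset.sum_congr rfl fun l hl => ?_).trans
      (hlr.trans (Finset.sum_congr rfl fun l hl => ?_))
    · have hli := Finset.mem_range_succ_iff.1 hl
      rw [Polynomial.coeff_one_sub_X_pow_eq, Nat.add_sub_cancel, Nat.sub_sub_self hli]
      ring
    · have hli := Finset.mem_range_succ_iff.1 hl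
      rw [← pow_add, Polynomial.coeff_one_sub_X_pow_eq]
      rcases lt_or_ge a l with h | h
      · simp [Nat.choose_eq_zero_of_lt h]
      · obtain ⟨k, rfl⟩ := Nat.exists_eq_add_of_le hli
        have hc : (a + x - l).choose (a + x - (l + k)) = (x + (a - l)).choose k := by
          rw [← Nat.choose_symm (n := x + (a - l)) (k := k) (by omega)]
          congr 1 <;> omega
        have hp : (-1 : ℚ) ^ (l + k + l) = (-1) ^ k := by
          rw [show l + k + l = k + 2 * l by ring, pow_add, pow_mul]
          simp
        rw [hc, hp, Nat.add_sub_cancel_left]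
        ring
  · congr 1
    rw [Finset.mul_sum]
    refine Finset.sum_congr rfl fun l _ => ?_
    simp only [map_mul, map_natCast]
    ring
  · congr 1
    rw [Finset.mul_sum]
    refine Finset.sum_congr rfl fun l _ => ?_
    simp only [map_mul, map_natCast]
    ring
end

section
/- The Hahn polynomials satisfy the three-term recurrence: for all natural numbers N, p, r, x with x ≤ p, x ≤ N−p and N ∉ {2r−3, 2r−2, 2r, 2r+1}, one has −x·H_r(x,N,p) = A_r·H_{r+1}(x,N,p) + B_r·H_r(x,N,p) + C_r·H_{r−1}(x,N,p), where A_r = (r−N+p)(p−r)(r+1)/((2r−N)(N−2r−1)), B_r = −(r²N − rN(N+1) + (2+N)(N−p)p)/((2r−N−2)(2r−N)), C_r = −(r−N−1+p)(r−p−1)(N−r+2)/((2r−N−2)(N−2r+3)), and H_{−1} := 0. -/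
/-- Generalized binomial coefficient `C(z, l) = z (z-1) ⋯ (z-l+1) / l!` for `z : ℚ`. -/
noncomputable def qchoose (z : ℚ) (l : ℕ) : ℚ :=
  (∏ m ∈ Finset.range l, (z - m)) / (Nat.factorial l : ℚ)

/-- Krawtchouk polynomial `K_i(x, N, p)`. -/
noncomputable def Kraw (i : ℕ) (x N p : ℚ) : ℚ :=
  ∑ l ∈ Finset.range (i + 1),
    (-1 : ℚ) ^ l * (p - 1) ^ (i - l) * qchoose x l * qchoose (N - x) (i - l)

/-- Eberlein polynomial `E_i(x, N, p)`. -/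
noncomputable def Eber (i : ℕ) (x N p : ℚ) : ℚ :=
  ∑ l ∈ Finset.range (i + 1),
    (-1 : ℚ) ^ l * qchoose x l * qchoose (p - x) (i - l) * qchoose (N - p - x) (i - l)

/-- Hahn polynomial `H_i(x, N, p) = ((C(N,i) - C(N,i-1)) / (C(p,x) C(N-p,x))) E_x(i, N, p)`,
with the convention `C(N, -1) = 0`. -/
noncomputable def Hahn (i x : ℕ) (N p : ℚ) : ℚ :=
  ((qchoose N i - if i = 0 then 0 else qchoose N (i - 1)) / (qchoose p x * qchoose (N - p) x))
    * Eber x (i : ℚ) N p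

/-- Krawtchouk polynomial with an integer index, with the convention `K_{-1} := 0`. -/
noncomputable def KrawZ (i : ℤ) (x N p : ℚ) : ℚ :=
  if i < 0 then 0 else Kraw i.toNat x N p

/-- Hahn polynomial with an integer index, with the convention `H_{-1} := 0`. -/
noncomputable def HahnZ (i : ℤ) (x : ℕ) (N p : ℚ) : ℚ :=
  if i < 0 then 0 else Hahn i.toNat x N p

open PowerSeries in
/-- The Euler operator `X * d/dX` on power series. -/
noncomputable def eulerOp (f : PowerSeries ℚ) : PowerSeries ℚ :=
  X * derivative ℚ f

open PowerSeries in
theorem coeff_eulerOp (f : PowerSeries ℚ) (n : ℕ) :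
    coeff n (eulerOp f) = n * coeff n f := by
  cases n with
  | zero => simp [eulerOp]
  | succ n =>
    rw [eulerOp, coeff_succ_X_mul, coeff_derivative]
    push_cast
    ring

theorem eulerOp_mul (f g : PowerSeries ℚ) :
    eulerOp (f * g) = eulerOp f * g + f * eulerOp g := by
  simp only [eulerOp, Derivation.leibniz, smul_eq_mul]
  ring

theorem eulerOp_add (f g : PowerSeries ℚ) : eulerOp (f + g) = eulerOp f + eulerOp g := by
  simp only [eulerOp, map_add]
  ring

theorem qchoose_zero (z : ℚ) : qchoose z 0 = 1 := by simp [qchoose]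

theorem succ_mul_qchoose_succ (z : ℚ) (l : ℕ) :
    ((l : ℚ) + 1) * qchoose z (l + 1) = (z - l) * qchoose z l := by
  have h : (Nat.factorial l : ℚ) ≠ 0 := by positivity
  have h' : (l : ℚ) + 1 ≠ 0 := by positivity
  simp only [qchoose, Finset.prod_range_succ, Nat.factorial_succ]
  push_cast
  field_simp

theorem add_one_mul_qchoose (z : ℚ) (l : ℕ) :
    (z + 1) * qchoose z l = (z + 1 - l) * qchoose (z + 1) l := by
  have h : (z + 1) * ∏ m ∈ Finset.range l, (z - m)
      = (z + 1 - l) * ∏ m ∈ Finset.range l, (z + 1 - m) := by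
    rw [mul_comm (z + 1 - (l : ℚ)), ← Finset.prod_range_succ (fun m : ℕ => z + 1 - (m : ℚ)),
      Finset.prod_range_succ', mul_comm]
    simp
  simp only [qchoose, mul_div_assoc', h]

theorem add_one_mul_qchoose_sub (z : ℚ) (i : ℕ) :
    (z + 1) * (qchoose z i - if i = 0 then 0 else qchoose z (i - 1))
      = (z + 1 - 2 * i) * qchoose (z + 1) i := by
  cases i with
  | zero => simp [qchoose_zero]
  | succ i =>
    have h1 := add_one_mul_qchoose z (i + 1)
    have h2 := add_one_mul_qchoose z i
    have h3 := succ_mul_qchoose_succ (z + 1) i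
    simp only [Nat.add_eq_zero_iff, one_ne_zero, and_false, if_false, Nat.add_sub_cancel]
    push_cast at *
    linear_combination h1 - h2 + h3

/-- The power series `(1 - X) ^ s`. -/
noncomputable def oneSubPow (s : ℚ) : PowerSeries ℚ :=
  PowerSeries.mk fun l => (-1 : ℚ) ^ l * qchoose s l

/-- The diagonal of `(1 + u) ^ a * (1 + v) ^ b`. -/
noncomputable def diagSeries (a b : ℚ) : PowerSeries ℚ :=
  PowerSeries.mk fun k => qchoose a k * qchoose b k

open PowerSeries in
theorem coeff_oneSubPow_mul_diagSeries (x : ℕ) (s N p : ℚ) :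
    coeff x (oneSubPow s * diagSeries (p - s) (N - p - s)) = Eber x s N p := by
  rw [coeff_mul, Finset.Nat.sum_antidiagonal_eq_sum_range_succ_mk, Eber]
  refine Finset.sum_congr rfl fun l _ => ?_
  simp only [oneSubPow, diagSeries, coeff_mk]
  ring

open PowerSeries in
theorem one_sub_X_mul_eulerOp_oneSubPow (s : ℚ) :
    (1 - X) * eulerOp (oneSubPow s) = -(C s * X * oneSubPow s) := by
  ext n
  cases n with
  | zero => simp [eulerOp]
  | succ n =>
    have h := succ_mul_qchoose_succ s n
    rw [sub_mul, one_mul, map_sub, coeff_succ_X_mul, coeff_eulerOp, coeff_eulerOp, map_neg,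
      mul_assoc, coeff_C_mul, coeff_succ_X_mul]
    simp only [oneSubPow, coeff_mk, pow_succ]
    push_cast
    linear_combination -(-1 : ℚ) ^ n * h

open PowerSeries in
theorem eulerOp_eulerOp_diagSeries (a b : ℚ) :
    eulerOp (eulerOp (diagSeries a b))
      = X * (C (a * b) * diagSeries a b - C (a + b) * eulerOp (diagSeries a b)
        + eulerOp (eulerOp (diagSeries a b))) := by
  ext n
  cases n with
  | zero => simp [eulerOp]
  | succ n =>
    have h := succ_mul_qchoose_succ a n
    have h' := succ_mul_qchoose_succ b n
    rw [coeff_succ_X_mul, map_add, map_sub, coeff_C_mul, coeff_C_mul]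
    simp only [coeff_eulerOp, diagSeries, coeff_mk]
    push_cast
    linear_combination ((n : ℚ) + 1) * qchoose b (n + 1) * h + (a - n) * qchoose a n * h'

open PowerSeries in
/-- The differential equation of the generating function of the Eberlein polynomials. -/
theorem eulerOp_eulerOp_eber (s N p : ℚ) (F : PowerSeries ℚ)
    (hF : F = oneSubPow s * diagSeries (p - s) (N - p - s)) :
    eulerOp (eulerOp F)
      + X * (C N * eulerOp F - 2 * eulerOp (eulerOp F) - C ((p - s) * (N - p - s) - s) * F)
      + X * (X * (C (p * (N - p)) * F - C N * eulerOp F + eulerOp (eulerOp F))) = 0 := by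
  have hT := one_sub_X_mul_eulerOp_oneSubPow s
  have hT2 := congrArg eulerOp hT
  have hD := eulerOp_eulerOp_diagSeries (p - s) (N - p - s)
  have hX : eulerOp (1 - X) = -X := by simp [eulerOp]
  have hC : eulerOp (-(C s * X * oneSubPow s))
      = -(C s * X * oneSubPow s) - C s * X * eulerOp (oneSubPow s) := by
    simp only [eulerOp, map_neg, Derivation.leibniz, smul_eq_mul, derivative_X, derivative_C]
    ring
  rw [eulerOp_mul, hX, hC] at hT2
  subst hF
  simp only [eulerOp_mul, eulerOp_add]
  generalize eulerOp (eulerOp (oneSubPow s)) = T2 at *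
  generalize eulerOp (oneSubPow s) = T1 at *
  generalize oneSubPow s = T at *
  generalize eulerOp (eulerOp (diagSeries (p - s) (N - p - s))) = D2 at *
  generalize eulerOp (diagSeries (p - s) (N - p - s)) = D1 at *
  generalize diagSeries (p - s) (N - p - s) = D at *
  simp only [map_sub, map_add, map_mul] at *
  linear_combination (1 - X) * D * hT2 + (1 - X) * T * hD
    + (C N * X * D + (1 - C s) * X * D + 2 * (1 - X) * D1) * hT

theorem eber_zero (s N p : ℚ) : Eber 0 s N p = 1 := by
  simp [Eber, qchoose_zero]

theorem eber_one (s N p : ℚ) : Eber 1 s N p = (p - s) * (N - p - s) - s := by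
  simp [Eber, Finset.sum_range_succ, qchoose]
  ring

open PowerSeries in
/-- The three-term recurrence of the Eberlein polynomials in the degree. -/
theorem eber_recurrence (x : ℕ) (s N p : ℚ) :
    ((x : ℚ) + 2) ^ 2 * Eber (x + 2) s N p
      = ((p - s) * (N - p - s) - s - (x + 1) * (N - 2 * (x + 1))) * Eber (x + 1) s N p
        - (p - x) * (N - p - x) * Eber x s N p := by
  have h := congrArg (coeff (x + 1 + 1)) (eulerOp_eulerOp_eber s N p _ rfl)
  obtain ⟨e, he⟩ : ∃ e, e = (p - s) * (N - p - s) - s := ⟨_, rfl⟩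
  rw [← he] at h ⊢
  have h2 (f : PowerSeries ℚ) : (2 : PowerSeries ℚ) * f = C 2 * f := by
    rw [map_ofNat]
  simp only [map_add, map_sub, coeff_succ_X_mul, coeff_eulerOp, h2, coeff_C_mul,
    coeff_oneSubPow_mul_diagSeries, map_zero] at h
  push_cast at h
  linear_combination h

/-- If three sequences satisfy the recurrence of the Eberlein polynomials, with spectral parameters
`θ + 1 + y`, `θ` and `θ + 1 - y`, then a linear relation between them with the coefficients of the
difference equation propagates from the first two terms. -/
theorem difference_of_recurrence (a b c : ℕ → ℚ) (N P y θ α γ : ℚ) (β : ℚ → ℚ)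
    (hβ : ∀ t, β t = -y * (t * (y ^ 2 - 1) - N * θ - 2 * P))
    (hy : y ^ 2 = (N + 1) ^ 2 + 4 * θ - 4 * P)
    (ha0 : a 0 = 1) (hb0 : b 0 = 1) (hc0 : c 0 = 1)
    (ha1 : a 1 = θ + 1 + y) (hb1 : b 1 = θ) (hc1 : c 1 = θ + 1 - y)
    (ha : ∀ n : ℕ, ((n : ℚ) + 2) ^ 2 * a (n + 2)
      = (θ + 1 + y - (n + 1) * (N - 2 * (n + 1))) * a (n + 1) - (P - n * N + n ^ 2) * a n)
    (hb : ∀ n : ℕ, ((n : ℚ) + 2) ^ 2 * b (n + 2)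
      = (θ - (n + 1) * (N - 2 * (n + 1))) * b (n + 1) - (P - n * N + n ^ 2) * b n)
    (hc : ∀ n : ℕ, ((n : ℚ) + 2) ^ 2 * c (n + 2)
      = (θ + 1 - y - (n + 1) * (N - 2 * (n + 1))) * c (n + 1) - (P - n * N + n ^ 2) * c n)
    (h0 : α + β 0 + γ = 0) (h1 : α * (θ + 1 + y) + β 1 * θ + γ * (θ + 1 - y) = 0) (n : ℕ) :
    α * a n + β n * b n + γ * c n = 0 := by
  have key : ∀ n : ℕ,
      (α * a n + β n * b n + γ * c n = 0 ∧
      α * (θ + 1 + y) * a n + γ * (θ + 1 - y) * c n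
        = -((n + 1) ^ 2 * (β (n + 1) - β (n - 1)) * b (n + 1)
          + (n * (N - 2 * n) * (β n - β (n - 1)) + θ * β (n - 1)) * b n)) ∧
      (α * a (n + 1) + β (n + 1) * b (n + 1) + γ * c (n + 1) = 0 ∧
      α * (θ + 1 + y) * a (n + 1) + γ * (θ + 1 - y) * c (n + 1)
        = -((n + 2) ^ 2 * (β (n + 2) - β n) * b (n + 2)
          + ((n + 1) * (N - 2 * (n + 1)) * (β (n + 1) - β n) + θ * β n) * b (n + 1))) := by
    intro n
    induction n with
    | zero =>
      have hb2 := hb 0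
      simp only [hβ, Nat.cast_zero, zero_add, ha0, hb0, hc0, ha1, hb1, hc1] at *
      refine ⟨⟨?_, ?_⟩, ?_, ?_⟩
      · linear_combination h0
      · linear_combination h1
      · linear_combination h1
      · linear_combination (-2 * y * (y ^ 2 - 1)) * hb2 + (2 * θ + 2) * h1
          - (θ + 1 + y) * (θ + 1 - y) * h0
    | succ n ih =>
      obtain ⟨⟨hP, hQ⟩, hP', hQ'⟩ := ih
      have ha' := ha n
      have hb' := hb n
      have hc' := hc n
      have hb'' := hb (n + 1)
      have hn : ((n : ℚ) + 2) ^ 2 ≠ 0 := by positivity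
      simp only [hβ] at *
      push_cast at *
      refine ⟨⟨hP', ?_⟩, ?_, ?_⟩
      · linear_combination hQ'
      · apply mul_left_cancel₀ hn
        linear_combination α * ha' + γ * hc' + hQ' - (n + 1) * (N - 2 * (n + 1)) * hP'
          - (P - n * N + n ^ 2) * hP
          - y * (n * (y ^ 2 - 1) - N * θ - 2 * P) * hb'
      · apply mul_left_cancel₀ hn
        linear_combination α * (θ + 1 + y) * ha' + γ * (θ + 1 - y) * hc' + (2 * θ + 2) * hQ'
          - (θ + 1 + y) * (θ + 1 - y) * hP' - (n + 1) * (N - 2 * (n + 1)) * hQ'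
          - (P - n * N + n ^ 2) * hQ
          + (θ * (-y * ((n - 1) * (y ^ 2 - 1) - N * θ - 2 * P))
            - n * (N - 2 * n) * (y * (y ^ 2 - 1))) * hb'
          + ((n : ℚ) + 2) ^ 2 * (-2 * y * (y ^ 2 - 1)) * hb''
          - y * (n + 1) * (1 - y ^ 2) * b (n + 1) * hy
  exact (key n).1.1

/-- The difference equation of the Eberlein polynomials in the argument. -/
theorem eber_difference (x : ℕ) (r N p : ℚ) :
    (r - N + p) * (p - r) * (N - r + 1) * (2 * r - N - 2) * Eber x (r + 1) N p
      + (x * (2 * r - N - 2) * (2 * r - N)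
          - (r ^ 2 * N - r * N * (N + 1) + (2 + N) * (N - p) * p))
        * (N - 2 * r + 1) * Eber x r N p
      - (r - N - 1 + p) * (r - p - 1) * r * (2 * r - N) * Eber x (r - 1) N p = 0 := by
  have h := difference_of_recurrence (fun n => Eber n (r + 1) N p) (fun n => Eber n r N p)
    (fun n => Eber n (r - 1) N p) N (p * (N - p)) (2 * r - N - 1) ((p - r) * (N - p - r) - r)
    ((r - N + p) * (p - r) * (N - r + 1) * (2 * r - N - 2))
    (-((r - N - 1 + p) * (r - p - 1) * r * (2 * r - N))) _ (fun _ => rfl) (by ring)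
    (eber_zero ..) (eber_zero ..) (eber_zero ..)
    (by rw [eber_one]; ring) (eber_one ..) (by rw [eber_one]; ring)
    (fun n => by linear_combination eber_recurrence n (r + 1) N p)
    (fun n => by linear_combination eber_recurrence n r N p)
    (fun n => by linear_combination eber_recurrence n (r - 1) N p)
    (by ring) (by ring) x
  linear_combination h

/-- Three-term recurrence of the Hahn polynomials. -/
theorem hahn_recurrence (N p r x : ℕ) (hxp : x ≤ p) (hxN : (x : ℤ) ≤ (N : ℤ) - p)
    (h1 : (N : ℤ) ≠ 2 * r - 3) (h2 : (N : ℤ) ≠ 2 * r - 2)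
    (h3 : (N : ℤ) ≠ 2 * r) (h4 : (N : ℤ) ≠ 2 * r + 1) :
    -(x : ℚ) * Hahn r x N p
  = (((r : ℚ) - N + p) * ((p : ℚ) - r) * ((r : ℚ) + 1)
      / ((2 * (r : ℚ) - N) * ((N : ℚ) - 2 * r - 1))) * Hahn (r + 1) x N p
  + (-(((r : ℚ) ^ 2 * N - (r : ℚ) * N * ((N : ℚ) + 1) + (2 + (N : ℚ)) * ((N : ℚ) - p) * p)
      / ((2 * (r : ℚ) - N - 2) * (2 * (r : ℚ) - N)))) * Hahn r x N p
  + (-((((r : ℚ) - N - 1 + p) * ((r : ℚ) - p - 1) * ((N : ℚ) - r + 2))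
      / ((2 * (r : ℚ) - N - 2) * ((N : ℚ) - 2 * r + 3)))) * HahnZ ((r : ℤ) - 1) x N p := by
  have hN : (N : ℚ) + 1 ≠ 0 := by positivity
  have d2 : 2 * (r : ℚ) - N - 2 ≠ 0 := fun h => h2 (by
    have : (N : ℚ) = 2 * r - 2 := by linear_combination -h
    exact_mod_cast this)
  have d3 : 2 * (r : ℚ) - N ≠ 0 := fun h => h3 (by
    have : (N : ℚ) = 2 * r := by linear_combination -h
    exact_mod_cast this)
  have d4 : (N : ℚ) - 2 * r - 1 ≠ 0 := fun h => h4 (by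
    have : (N : ℚ) = 2 * r + 1 := by linear_combination h
    exact_mod_cast this)
  have d1 : (N : ℚ) - 2 * r + 3 ≠ 0 := fun h => h1 (by
    have : (N : ℚ) = 2 * r - 3 := by linear_combination h
    exact_mod_cast this)
  obtain ⟨t, ht⟩ : ∃ t, (N + 1 : ℚ) * t = qchoose (N + 1) r := ⟨_, mul_div_cancel₀ _ hN⟩
  have hE := eber_difference x r N p
  have hm : (qchoose (N : ℚ) r - if r = 0 then 0 else qchoose (N : ℚ) (r - 1))
      = (N + 1 - 2 * r) * t := by
    apply mul_left_cancel₀ hN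
    rw [add_one_mul_qchoose_sub, ← ht]
    ring
  have hm' : ((r : ℚ) + 1)
        * (qchoose (N : ℚ) (r + 1) - if r + 1 = 0 then 0 else qchoose (N : ℚ) (r + 1 - 1))
      = (N - 2 * r - 1) * (N + 1 - r) * t := by
    apply mul_left_cancel₀ hN
    have h := add_one_mul_qchoose_sub N (r + 1)
    have h' := succ_mul_qchoose_succ ((N : ℚ) + 1) r
    rw [if_neg r.succ_ne_zero, Nat.add_sub_cancel] at h ⊢
    push_cast at h
    linear_combination ((r : ℚ) + 1) * h + (N - 2 * r - 1) * h' - (N - 2 * r - 1) * (N + 1 - r) * ht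
  have hC : ((N : ℚ) - r + 2) * HahnZ ((r : ℤ) - 1) x N p
      = (N - 2 * r + 3) * (r * t) / (qchoose p x * qchoose (N - p) x) * Eber x (r - 1) N p := by
    cases r with
    | zero => simp [HahnZ]
    | succ r =>
      have h := add_one_mul_qchoose_sub N r
      have h' := succ_mul_qchoose_succ ((N : ℚ) + 1) r
      have h'' : ((N : ℚ) - r + 1) * (qchoose (N : ℚ) r - if r = 0 then 0 else qchoose (N : ℚ) (r - 1))
          = (N - 2 * r + 1) * ((r + 1) * t) := by
        apply mul_left_cancel₀ hN
        linear_combination ((N : ℚ) - r + 1) * h - (N - 2 * r + 1) * h'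
          - (N - 2 * r + 1) * (r + 1) * ht
      have hr : HahnZ (((r + 1 : ℕ) : ℤ) - 1) x N p = Hahn r x N p := by simp [HahnZ]
      have e1 : (N : ℚ) - ((r + 1 : ℕ) : ℚ) + 2 = N - r + 1 := by push_cast; ring
      have e2 : (N : ℚ) - 2 * ((r + 1 : ℕ) : ℚ) + 3 = N - 2 * r + 1 := by push_cast; ring
      have e3 : ((r + 1 : ℕ) : ℚ) - 1 = r := by push_cast; ring
      rw [hr, Hahn, e1, e2, e3, ← mul_assoc, mul_div_assoc', h'']
      push_cast
      rfl
  have hA : ((r : ℚ) + 1) * Hahn (r + 1) x N p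
      = (N - 2 * r - 1) * (N + 1 - r) * t / (qchoose p x * qchoose (N - p) x)
        * Eber x (r + 1) N p := by
    rw [Hahn, ← mul_assoc, mul_div_assoc', hm']
    push_cast
    rfl
  have hB : Hahn r x N p
      = (N + 1 - 2 * r) * t / (qchoose p x * qchoose (N - p) x) * Eber x r N p := by
    rw [Hahn, hm]
  have e (a b c d e : ℚ) : a * b * c / d * e = a * b / d * (c * e) := by ring
  have e' (a b c d e : ℚ) : -(a * b * c / d) * e = -(a * b / d * (c * e)) := by ring
  rw [e, e', hA, hB, hC]
  generalize qchoose (p : ℚ) x * qchoose ((N : ℚ) - p) x = Q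
  simp only [div_eq_mul_inv _ Q]
  generalize Q⁻¹ = q
  field_simp
  linear_combination -t * q * hE
end

section
/- The Hahn polynomials satisfy the parameter-shift relation: for all natural numbers N, p, r, x with p ≥ 1, x ≤ p−1, x ≤ N−p, N ≠ 2r and N ≠ 2r−2, one has H_r(x,N,p) = (N/p)·( ((p−r)/(N−2r))·H_r(x,N−1,p−1) + ((N−p−r+1)/(N−2r+2))·H_{r−1}(x,N−1,p−1) ), where H_{−1} := 0. -/
theorem qchoose_succ_mul (z : ℚ) (m : ℕ) :
    qchoose z (m + 1) * (m + 1) = qchoose z m * (z - m) := by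
  have h : (m.factorial : ℚ) ≠ 0 := by exact_mod_cast m.factorial_ne_zero
  simp only [qchoose, Finset.prod_range_succ, Nat.factorial_succ]
  push_cast
  field_simp

theorem qchoose_add_one_succ_mul (z : ℚ) (m : ℕ) :
    qchoose (z + 1) (m + 1) * (m + 1) = (z + 1) * qchoose z m := by
  have h : (m.factorial : ℚ) ≠ 0 := by exact_mod_cast m.factorial_ne_zero
  simp only [qchoose, Finset.prod_range_succ', Nat.factorial_succ]
  push_cast
  simp only [add_sub_add_right_eq_sub]
  field_simp
  ring

theorem sub_mul_qchoose_add_one (z : ℚ) (m : ℕ) :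
    (z + 1 - m) * qchoose (z + 1) m = (z + 1) * qchoose z m := by
  linarith [qchoose_succ_mul (z + 1) m, qchoose_add_one_succ_mul z m]

theorem qchoose_add_one_sub (a : ℚ) (m : ℕ) :
    (a + 1) * (qchoose (a + 1) m - qchoose a m) - m * qchoose a m = m * qchoose a (m - 1) := by
  cases m with
  | zero => simp [qchoose_zero]
  | succ m =>
    have h1 := qchoose_succ_mul a m
    have h2 := qchoose_add_one_succ_mul a m
    have hm : (m : ℚ) + 1 ≠ 0 := by positivity
    have h3 : qchoose (a + 1) (m + 1) = qchoose a (m + 1) + qchoose a m := by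
      apply mul_right_cancel₀ hm
      linear_combination h2 - h1
    rw [h3]
    simp only [Nat.add_sub_cancel]
    push_cast
    linear_combination -h1

theorem qchoose_ne_zero {n k : ℕ} (h : k ≤ n) : qchoose n k ≠ 0 := by
  refine div_ne_zero (Finset.prod_ne_zero_iff.mpr fun m hm => ?_)
    (by exact_mod_cast k.factorial_ne_zero)
  rw [Finset.mem_range] at hm
  have : (m : ℚ) < n := by exact_mod_cast hm.trans_le h
  linarith

theorem eber_shift_partial_sum (r A a : ℚ) (x k : ℕ) (hk : k ≤ x) :
    ∑ l ∈ Finset.range (k + 1),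
      ((A + a + 1) * (A + r - x) *
          ((-1) ^ l * qchoose r l * qchoose A (x - l) * qchoose a (x - l))
        - A * (A + a + r + 1) *
          ((-1) ^ l * qchoose r l * qchoose (A - 1) (x - l) * qchoose a (x - l))
        - r * (a + 1) *
          ((-1) ^ l * qchoose (r - 1) l * qchoose A (x - l) * qchoose (a + 1) (x - l)))
    = -((-1) ^ k * (r - k) * qchoose r k * ((x - k : ℕ) * qchoose A (x - k))
        * qchoose a (x - k - 1)) := by
  have key (l m : ℕ) (hx : x = l + m) :
      (A + a + 1) * (A + r - x) * ((-1) ^ l * qchoose r l * qchoose A m * qchoose a m)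
        - A * (A + a + r + 1) * ((-1) ^ l * qchoose r l * qchoose (A - 1) m * qchoose a m)
        - r * (a + 1) * ((-1) ^ l * qchoose (r - 1) l * qchoose A m * qchoose (a + 1) m)
      = -((-1) ^ l * (r - l) * qchoose r l * (m * qchoose A m) * qchoose a (m - 1))
        - (-1) ^ l * l * qchoose r l * ((A - m) * qchoose A m) * qchoose a m := by
    have h1 := sub_mul_qchoose_add_one (A - 1) m
    have h2 := sub_mul_qchoose_add_one (r - 1) l
    have h3 := qchoose_add_one_sub a m
    simp only [sub_add_cancel] at h1 h2
    rw [hx]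
    push_cast
    linear_combination
      (A + a + r + 1) * (-1) ^ l * qchoose r l * qchoose a m * h1
        + (a + 1) * (-1) ^ l * qchoose A m * qchoose (a + 1) m * h2
        - (-1) ^ l * (r - l) * qchoose r l * qchoose A m * h3
  induction k with
  | zero =>
    rw [Finset.sum_range_one, key 0 (x - 0) (by simp)]
    simp
  | succ k ih =>
    obtain ⟨m, rfl⟩ := Nat.exists_eq_add_of_le hk
    rw [Finset.sum_range_succ, ih (by omega), key (k + 1) _ (by omega)]
    have e1 : k + 1 + m - k = m + 1 := by omega
    have e2 : k + 1 + m - (k + 1) = m := by omega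
    rw [e1, e2, Nat.add_sub_cancel]
    have h1 := qchoose_succ_mul A m
    have h2 := qchoose_succ_mul r k
    push_cast
    rw [pow_succ]
    linear_combination
      -((-1) ^ k * (r - k) * qchoose r k * qchoose a m) * h1
        + ((-1) ^ k * (A - m) * qchoose A m * qchoose a m) * h2

theorem eber_shift (x : ℕ) (r N p : ℚ) :
    (N - 2 * r + 1) * (p - x) * Eber x r N p
      = (p - r) * (N - r + 1) * Eber x r (N - 1) (p - 1)
        + r * (N - p - r + 1) * Eber x (r - 1) (N - 1) (p - 1) := by
  have h := eber_shift_partial_sum r (p - r) (N - p - r) x x le_rfl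
  simp only [Finset.sum_sub_distrib, ← Finset.mul_sum, Nat.sub_self, Nat.cast_zero, zero_mul,
    mul_zero, neg_zero] at h
  have e1 : p - 1 - r = p - r - 1 := by ring
  have e2 : N - 1 - (p - 1) - r = N - p - r := by ring
  have e3 : p - 1 - (r - 1) = p - r := by ring
  have e4 : N - 1 - (p - 1) - (r - 1) = N - p - r + 1 := by ring
  simp only [Eber, e1, e2, e3, e4]
  linear_combination h

theorem eber_zero_s3 (x : ℕ) (N p : ℚ) : Eber x 0 N p = qchoose p x * qchoose (N - p) x := by
  rw [Eber, Finset.sum_range_succ', Finset.sum_eq_zero]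
  · simp [qchoose_zero]
  · intro l _
    simp [qchoose, Finset.prod_range_succ']

/-- Parameter-shift relation for the Hahn polynomials. -/
theorem hahn_parameter_shift (N p r x : ℕ) (hp : 1 ≤ p)
    (hxp : (x : ℤ) ≤ (p : ℤ) - 1) (hxN : (x : ℤ) ≤ (N : ℤ) - p)
    (h1 : (N : ℤ) ≠ 2 * r) (h2 : (N : ℤ) ≠ 2 * r - 2) :
    Hahn r x N p
  = ((N : ℚ) / p) *
      ( (((p : ℚ) - r) / ((N : ℚ) - 2 * r)) * Hahn r x ((N : ℚ) - 1) ((p : ℚ) - 1)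
      + (((N : ℚ) - p - r + 1) / ((N : ℚ) - 2 * r + 2))
          * HahnZ ((r : ℤ) - 1) x ((N : ℚ) - 1) ((p : ℚ) - 1) ) := by
  have hpN : p ≤ N := by omega
  have hp0 : (p : ℚ) ≠ 0 := by positivity
  have hN0 : (N : ℚ) ≠ 0 := by
    have : N ≠ 0 := by omega
    exact_mod_cast this
  have hd1 : (N : ℚ) - 2 * r ≠ 0 := fun h => h1 (by
    have : (N : ℚ) = 2 * r := by linarith
    exact_mod_cast this)
  have hd2 : (N : ℚ) - 2 * r + 2 ≠ 0 := fun h => h2 (by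
    have : (N : ℚ) = 2 * r - 2 := by linarith
    exact_mod_cast this)
  have hP : qchoose (p : ℚ) x ≠ 0 := qchoose_ne_zero (by omega)
  have hP' : qchoose ((p : ℚ) - 1) x ≠ 0 := by
    have := qchoose_ne_zero (n := p - 1) (k := x) (by omega)
    rwa [Nat.cast_sub hp, Nat.cast_one] at this
  have hQ : qchoose ((N : ℚ) - p) x ≠ 0 := by
    have := qchoose_ne_zero (n := N - p) (k := x) (by omega)
    rwa [Nat.cast_sub hpN] at this
  have hPP := sub_mul_qchoose_add_one ((p : ℚ) - 1) x
  rw [sub_add_cancel] at hPP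
  have hQe : (N : ℚ) - 1 - (p - 1) = N - p := by ring
  cases r with
  | zero =>
    simp only [Hahn, HahnZ, Nat.cast_zero, eber_zero_s3, hQe]
    simp [qchoose_zero]
    field_simp
  | succ r =>
    have hE := eber_shift x ((r + 1 : ℕ) : ℚ) N p
    have hi : ((r + 1 : ℕ) : ℤ) - 1 = (r : ℤ) := by push_cast; ring
    have hr : (r : ℚ) + 1 ≠ 0 := by positivity
    -- both leading coefficients at `N - 1` are multiples of binomials at `N`
    have c0 := qchoose_succ_mul (N : ℚ) r
    have c1 : (qchoose ((N : ℚ) - 1) (r + 1) - qchoose ((N : ℚ) - 1) r) * N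
        = (N - 2 * (r + 1 : ℕ)) * qchoose N (r + 1) := by
      have a1 := sub_mul_qchoose_add_one ((N : ℚ) - 1) (r + 1)
      have a2 := qchoose_add_one_succ_mul ((N : ℚ) - 1) r
      rw [sub_add_cancel] at a1 a2
      push_cast at a1 ⊢
      linear_combination a2 - a1
    have c2 : (qchoose ((N : ℚ) - 1) r - if r = 0 then 0 else qchoose ((N : ℚ) - 1) (r - 1)) * N
        = (N - 2 * (r + 1 : ℕ) + 2) * qchoose N r := by
      cases r with
      | zero => simp [qchoose_zero]
      | succ r =>
        have a1 := sub_mul_qchoose_add_one ((N : ℚ) - 1) (r + 1)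
        have a2 := qchoose_add_one_succ_mul ((N : ℚ) - 1) r
        rw [sub_add_cancel] at a1 a2
        simp only [Nat.add_sub_cancel, Nat.add_eq_zero_iff, one_ne_zero, and_false, if_false]
        push_cast at a1 ⊢
        linear_combination a2 - a1
    have hre : ((r + 1 : ℕ) : ℚ) - 1 = r := by push_cast; ring
    rw [hre] at hE
    rw [hi, HahnZ, if_neg (by omega), Int.toNat_natCast]
    simp only [Hahn, hQe, Nat.add_sub_cancel, Nat.add_eq_zero_iff, one_ne_zero, and_false,
      if_false]
    rw [eq_div_of_mul_eq hN0 c1, eq_div_of_mul_eq hN0 c2]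
    generalize Eber x ((r + 1 : ℕ) : ℚ) N p = E0 at *
    generalize Eber x ((r + 1 : ℕ) : ℚ) (N - 1) (p - 1) = E1 at *
    generalize Eber x (r : ℚ) (N - 1) (p - 1) = E2 at *
    generalize qchoose (N : ℚ) (r + 1) = B1 at *
    generalize qchoose (N : ℚ) r = B0 at *
    have hmain : (B1 - B0) * (p - x) * E0
        = (p - (r + 1 : ℕ)) * B1 * E1 + (N - p - (r + 1 : ℕ) + 1) * B0 * E2 := by
      apply mul_right_cancel₀ hr
      push_cast at hE ⊢
      linear_combination B0 * hE
        + ((p - x) * E0 - (p - (r + 1)) * E1) * c0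
    have hxp' : (p : ℚ) - x ≠ 0 := by
      have : (x : ℤ) < p := by omega
      have : (x : ℚ) < p := by exact_mod_cast this
      linarith
    rw [eq_div_of_mul_eq hxp' ((mul_comm _ _).trans hPP)]
    clear c1 c2 hE
    generalize (N : ℚ) - 2 * (r + 1 : ℕ) + 2 = d2 at *
    generalize (N : ℚ) - 2 * (r + 1 : ℕ) = d1 at *
    field_simp
    linear_combination hmain
end

section
/- The adjacency matrices of the non-binary Johnson scheme satisfy, for every (i,j) ∈ ℕ², the product relation A_{10}·A_{ij} = (k−i−j+1)(r−2)·A_{i−1,j} + (i(r−3)+j(r−2))·A_{ij} + (i+1)·A_{i+1,j}, where A_{a,b} := 0 whenever a < 0 or b < 0. -/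
/-- The vertex set of the non-binary Johnson scheme `J_r(k, n)`: words of length `n`
over the alphabet `{0, 1, …, r-1}` of weight `k` (number of nonzero letters). -/
abbrev JohnsonVertex (r n k : ℕ) :=
  {x : Fin n → Fin r // (Finset.univ.filter fun i => (x i).val ≠ 0).card = k}

/-- Number of equal nonzero components `e(x, y)`. -/
def ecnt {r n : ℕ} (x y : Fin n → Fin r) : ℕ :=
  (Finset.univ.filter fun i => x i = y i ∧ (x i).val ≠ 0).card

/-- Number of common nonzeros `c(x, y)`. -/
def ccnt {r n : ℕ} (x y : Fin n → Fin r) : ℕ :=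
  (Finset.univ.filter fun i => (x i).val ≠ 0 ∧ (y i).val ≠ 0).card

/-- Adjacency matrix `A_{ij}` of the non-binary Johnson scheme `J_r(k, n)`,
with the convention `A_{ij} := 0` whenever `i < 0` or `j < 0`. -/
def Amat (r n k : ℕ) (i j : ℤ) : Matrix (JohnsonVertex r n k) (JohnsonVertex r n k) ℚ :=
  if i < 0 ∨ j < 0 then 0 else
    Matrix.of fun x y =>
      if (ecnt x.1 y.1 : ℤ) = (k : ℤ) - i - j ∧ (ccnt x.1 y.1 : ℤ) = (k : ℤ) - j then 1 else 0

/-- The letters that may replace a nonzero letter `u`: nonzero and different from `u`. -/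
def replacements {r : ℕ} (u : Fin r) : Finset (Fin r) :=
  Finset.univ.filter fun a => a.val ≠ 0 ∧ a ≠ u

theorem card_replacements {r : ℕ} (hr : 2 ≤ r) (u : Fin r) (hu : u.val ≠ 0) :
    ((replacements u).card : ℚ) = (r : ℚ) - 2 := by
  have h : replacements u = (Finset.univ.erase (⟨0, by omega⟩ : Fin r)).erase u := by
    ext a
    simp [replacements, Fin.ext_iff, and_comm]
  have hmem : u ∈ Finset.univ.erase (⟨0, by omega⟩ : Fin r) := by
    simpa [Fin.ext_iff] using hu
  rw [h, Finset.card_erase_of_mem hmem, Finset.card_erase_of_mem (Finset.mem_univ _),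
    Finset.card_univ, Fintype.card_fin, Nat.sub_sub, Nat.cast_sub (by omega)]
  norm_num

theorem sum_replacements {r : ℕ} (hr : 2 ≤ r) (u v : Fin r) (hu : u.val ≠ 0) (X Y : ℚ) :
    ∑ a ∈ replacements u, (if a = v then X else Y)
      = ((r : ℚ) - 2) * Y + if v.val ≠ 0 ∧ v ≠ u then X - Y else 0 := by
  have h : ∀ a : Fin r, (if a = v then X else Y) = Y + if a = v then X - Y else 0 := by
    intro a
    split_ifs <;> ring
  simp only [h, Finset.sum_add_distrib, Finset.sum_const, nsmul_eq_mul,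
    card_replacements hr u hu, Finset.sum_ite_eq']
  simp [replacements]

/-- The single-letter modifications of a word `x` that preserve its support. -/
def modifications {r n : ℕ} (x : Fin n → Fin r) : Finset (Σ _ : Fin n, Fin r) :=
  (Finset.univ.filter fun p => (x p).val ≠ 0).sigma fun p => replacements (x p)

theorem mem_modifications {r n : ℕ} (x : Fin n → Fin r) (t : Σ _ : Fin n, Fin r) :
    t ∈ modifications x ↔ (x t.1).val ≠ 0 ∧ t.2.val ≠ 0 ∧ t.2 ≠ x t.1 := by
  simp [modifications, replacements]

theorem update_ne_zero_iff {r n : ℕ} (x : Fin n → Fin r) (p : Fin n) (a : Fin r)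
    (hx : (x p).val ≠ 0) (ha : a.val ≠ 0) (q : Fin n) :
    (Function.update x p a q).val ≠ 0 ↔ (x q).val ≠ 0 := by
  by_cases h : q = p
  · subst h; simp [hx, ha]
  · simp [h]

theorem ccnt_update {r n : ℕ} (x y : Fin n → Fin r) (p : Fin n) (a : Fin r)
    (hx : (x p).val ≠ 0) (ha : a.val ≠ 0) :
    ccnt (Function.update x p a) y = ccnt x y := by
  simp only [ccnt, update_ne_zero_iff x p a hx ha]

theorem ecnt_eq_sum {r n : ℕ} (x y : Fin n → Fin r) :
    (ecnt x y : ℤ) = ∑ q, if x q = y q ∧ (x q).val ≠ 0 then (1 : ℤ) else 0 := by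
  simp [ecnt]

theorem ecnt_update {r n : ℕ} (x y : Fin n → Fin r) (p : Fin n) (a : Fin r)
    (hx : (x p).val ≠ 0) (ha : a.val ≠ 0) :
    (ecnt (Function.update x p a) y : ℤ)
      = ecnt x y - (if x p = y p then 1 else 0) + if a = y p then 1 else 0 := by
  rw [ecnt_eq_sum, ecnt_eq_sum, ← Finset.add_sum_erase _ _ (Finset.mem_univ p),
    ← Finset.add_sum_erase Finset.univ (fun q => if x q = y q ∧ (x q).val ≠ 0 then (1 : ℤ) else 0)
      (Finset.mem_univ p)]
  have h : ∀ q ∈ Finset.univ.erase p,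
      (if Function.update x p a q = y q ∧ (Function.update x p a q).val ≠ 0 then (1 : ℤ) else 0)
        = if x q = y q ∧ (x q).val ≠ 0 then 1 else 0 := by
    intro q hq
    rw [Function.update_of_ne (Finset.ne_of_mem_erase hq)]
  rw [Finset.sum_congr rfl h]
  simp only [Function.update_self, hx, ha, ne_eq, not_false_eq_true, and_true]
  ring

theorem eq_update_of_counts {r n k : ℕ} (x z : JohnsonVertex r n k)
    (he : ecnt x.1 z.1 + 1 = k) (hc : ccnt x.1 z.1 = k) :
    ∃ p, (x.1 p).val ≠ 0 ∧ (z.1 p).val ≠ 0 ∧ z.1 p ≠ x.1 p ∧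
      Function.update x.1 p (z.1 p) = z.1 := by
  obtain ⟨x, hx⟩ := x
  obtain ⟨z, hz⟩ := z
  simp only at *
  have hxs : (Finset.univ.filter fun i => (x i).val ≠ 0 ∧ (z i).val ≠ 0)
      = Finset.univ.filter fun i => (x i).val ≠ 0 :=
    Finset.eq_of_subset_of_card_le (fun i => by simp +contextual) (by rw [hx]; exact hc.ge)
  have hzs : (Finset.univ.filter fun i => (x i).val ≠ 0 ∧ (z i).val ≠ 0)
      = Finset.univ.filter fun i => (z i).val ≠ 0 :=
    Finset.eq_of_subset_of_card_le (fun i => by simp +contextual) (by rw [hz]; exact hc.ge)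
  have hsupp : ∀ i, (x i).val ≠ 0 ↔ (z i).val ≠ 0 := by
    intro i
    simpa using Finset.ext_iff.1 (hxs.symm.trans hzs) i
  have hsub : (Finset.univ.filter fun i => x i = z i ∧ (x i).val ≠ 0)
      ⊆ Finset.univ.filter fun i => (x i).val ≠ 0 := fun i => by simp
  have hcard : ((Finset.univ.filter fun i => (x i).val ≠ 0) \
      (Finset.univ.filter fun i => x i = z i ∧ (x i).val ≠ 0)).card = 1 := by
    rw [Finset.card_sdiff_of_subset hsub, hx]
    unfold ecnt at he
    omega
  obtain ⟨p, hp⟩ := Finset.card_eq_one.1 hcard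
  have hmem : ∀ i, ((x i).val ≠ 0 ∧ x i ≠ z i) ↔ i = p := by
    intro i
    have := Finset.ext_iff.1 hp i
    simp only [Finset.mem_sdiff, Finset.mem_filter, Finset.mem_univ, true_and,
      Finset.mem_singleton] at this
    rw [← this]
    tauto
  obtain ⟨h0, h1⟩ := (hmem p).2 rfl
  refine ⟨p, h0, (hsupp p).1 h0, h1.symm, ?_⟩
  funext q
  by_cases hq : q = p
  · subst hq; simp
  · rw [Function.update_of_ne hq]
    by_cases hxq : (x q).val = 0
    · have hzq : (z q).val = 0 := by
        by_contra h
        exact (hsupp q).2 h hxq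
      exact Fin.ext (hxq.trans hzq.symm)
    · by_contra h
      exact hq ((hmem q).1 ⟨hxq, h⟩)

theorem ecnt_self {r n k : ℕ} (x : JohnsonVertex r n k) : ecnt x.1 x.1 = k := by
  simpa [ecnt] using x.2

theorem ccnt_self {r n k : ℕ} (x : JohnsonVertex r n k) : ccnt x.1 x.1 = k := by
  simpa [ccnt] using x.2

theorem ecnt_comm {r n : ℕ} (x y : Fin n → Fin r) : ecnt x y = ecnt y x := by
  unfold ecnt
  congr 1
  ext i
  simp only [Finset.mem_filter, Finset.mem_univ, true_and]
  constructor <;> rintro ⟨h, h'⟩ <;> exact ⟨h.symm, by rwa [h] at h'⟩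

theorem ccnt_comm {r n : ℕ} (x y : Fin n → Fin r) : ccnt x y = ccnt y x := by
  simp only [ccnt, and_comm]

theorem sum_neighbors {r n k : ℕ} (x : JohnsonVertex r n k) (f : (Fin n → Fin r) → ℚ) :
    ∑ z : JohnsonVertex r n k,
        (if (ecnt x.1 z.1 : ℤ) = (k : ℤ) - 1 - 0 ∧ (ccnt x.1 z.1 : ℤ) = (k : ℤ) - 0
          then (1 : ℚ) else 0) * f z.1
      = ∑ t ∈ modifications x.1, f (Function.update x.1 t.1 t.2) := by
  simp only [ite_mul, one_mul, zero_mul]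
  rw [← Finset.sum_filter]
  symm
  refine Finset.sum_bij
    (fun t ht => (⟨Function.update x.1 t.1 t.2, ?_⟩ : JohnsonVertex r n k)) ?_ ?_ ?_ ?_
  · obtain ⟨h0, h1, -⟩ := (mem_modifications _ _).1 ht
    simp only [update_ne_zero_iff x.1 t.1 t.2 h0 h1]
    exact x.2
  · intro t ht
    obtain ⟨h0, h1, h2⟩ := (mem_modifications _ _).1 ht
    simp only [Finset.mem_filter, Finset.mem_univ, true_and]
    rw [ecnt_comm, ccnt_comm, ecnt_update _ _ _ _ h0 h1, ccnt_update _ _ _ _ h0 h1,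
      ecnt_self, ccnt_self]
    simp [h2]
  · rintro ⟨p, a⟩ ht ⟨q, b⟩ hs h
    obtain ⟨-, -, h2⟩ := (mem_modifications _ _).1 ht
    have h' := Subtype.ext_iff.1 h
    simp only at h' h2
    have hpq : p = q := by
      by_contra hne
      have := congrFun h' p
      rw [Function.update_self, Function.update_of_ne hne] at this
      exact h2 this
    subst hpq
    have := congrFun h' p
    simp only [Function.update_self] at this
    rw [this]
  · intro z hz
    simp only [Finset.mem_filter, Finset.mem_univ, true_and] at hz
    obtain ⟨p, h0, h1, h2, h3⟩ := eq_update_of_counts x z (by omega) (by omega)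
    exact ⟨⟨p, z.1 p⟩, (mem_modifications _ _).2 ⟨h0, h1, h2⟩, Subtype.ext h3⟩
  · intro t ht
    rfl

theorem sum_ecnt_modifications {r n k : ℕ} (hr : 2 ≤ r) (x y : JohnsonVertex r n k)
    (G : ℤ → ℚ) :
    ∑ t ∈ modifications x.1, G (ecnt (Function.update x.1 t.1 t.2) y.1)
      = ((r : ℚ) - 2) * ecnt x.1 y.1 * G (ecnt x.1 y.1 - 1)
        + ((r : ℚ) - 2) * (k - ecnt x.1 y.1) * G (ecnt x.1 y.1)
        + (ccnt x.1 y.1 - ecnt x.1 y.1) * (G (ecnt x.1 y.1 + 1) - G (ecnt x.1 y.1)) := by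
  set E : ℤ := (ecnt x.1 y.1 : ℤ) with hE
  have inner : ∀ p ∈ Finset.univ.filter (fun p => (x.1 p).val ≠ 0),
      ∑ a ∈ replacements (x.1 p), G (ecnt (Function.update x.1 p a) y.1)
        = ((r : ℚ) - 2) * G E
          + (if x.1 p = y.1 p then ((r : ℚ) - 2) * (G (E - 1) - G E) - (G (E + 1) - G E) else 0)
          + (if (y.1 p).val ≠ 0 then G (E + 1) - G E else 0) := by
    intro p hp
    have hx : (x.1 p).val ≠ 0 := (Finset.mem_filter.1 hp).2
    have hG : ∀ a ∈ replacements (x.1 p), G (ecnt (Function.update x.1 p a) y.1)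
        = if a = y.1 p then G (E - (if x.1 p = y.1 p then 1 else 0) + 1)
          else G (E - (if x.1 p = y.1 p then 1 else 0)) := by
      intro a ha
      rw [ecnt_update _ _ _ _ hx (Finset.mem_filter.1 ha).2.1]
      by_cases h : a = y.1 p <;> simp [h, hE]
    rw [Finset.sum_congr rfl hG, sum_replacements hr _ _ hx]
    by_cases h : x.1 p = y.1 p
    · have hy : (y.1 p).val ≠ 0 := h ▸ hx
      simp only [h, hy, ne_eq, not_true_eq_false, and_false, if_true, if_false,
        not_false_eq_true]
      ring
    · have h' : y.1 p ≠ x.1 p := Ne.symm h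
      simp [h, h']
  unfold modifications
  rw [Finset.sum_sigma, Finset.sum_congr rfl inner, Finset.sum_add_distrib,
    Finset.sum_add_distrib, ← Finset.sum_filter, ← Finset.sum_filter]
  simp only [Finset.sum_const, nsmul_eq_mul, Finset.filter_filter]
  have h1 : (Finset.univ.filter fun p => (x.1 p).val ≠ 0 ∧ x.1 p = y.1 p).card
      = ecnt x.1 y.1 := by
    simp only [ecnt, and_comm]
  have h2 : (Finset.univ.filter fun p => (x.1 p).val ≠ 0 ∧ (y.1 p).val ≠ 0).card
      = ccnt x.1 y.1 := rfl
  rw [h1, h2, x.2]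
  ring

theorem ecnt_le_ccnt {r n : ℕ} (x y : Fin n → Fin r) : ecnt x y ≤ ccnt x y := by
  refine Finset.card_le_card fun i hi => ?_
  obtain ⟨h, h'⟩ := (Finset.mem_filter.1 hi).2
  exact Finset.mem_filter.2 ⟨Finset.mem_univ _, h', h ▸ h'⟩

theorem Amat_apply {r n k : ℕ} {i j : ℤ} (hi : -1 ≤ i) (hj : 0 ≤ j)
    (x y : JohnsonVertex r n k) :
    Amat r n k i j x y
      = if (ecnt x.1 y.1 : ℤ) = (k : ℤ) - i - j ∧ (ccnt x.1 y.1 : ℤ) = (k : ℤ) - j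
        then 1 else 0 := by
  unfold Amat
  split_ifs with h h' h'
  · have := ecnt_le_ccnt x.1 y.1
    omega
  · rfl
  · simp [h']
  · simp [h']

/-- Product relation `A_{10} A_{ij}` in the non-binary Johnson scheme. -/
theorem johnson_A10_product (r n k : ℕ) (hr : 3 ≤ r) (hn : 1 ≤ n) (hk : k ≤ n) (i j : ℕ) :
    Amat r n k 1 0 * Amat r n k i j
  = (((k : ℚ) - i - j + 1) * ((r : ℚ) - 2)) • Amat r n k ((i : ℤ) - 1) j
    + ((i : ℚ) * ((r : ℚ) - 3) + (j : ℚ) * ((r : ℚ) - 2)) • Amat r n k i j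
    + ((i : ℚ) + 1) • Amat r n k ((i : ℤ) + 1) j := by
  ext x y
  simp only [Matrix.mul_apply, Matrix.add_apply, Matrix.smul_apply, smul_eq_mul]
  have hj : (0 : ℤ) ≤ j := by omega
  rw [Amat_apply (by omega) hj, Amat_apply (by omega) hj, Amat_apply (by omega) hj]
  simp only [Amat_apply (show (-1 : ℤ) ≤ 1 by omega) le_rfl,
    Amat_apply (show (-1 : ℤ) ≤ i by omega) hj]
  rw [sum_neighbors x fun z => if (ecnt z y.1 : ℤ) = (k : ℤ) - i - j ∧
    (ccnt z y.1 : ℤ) = (k : ℤ) - j then 1 else 0]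
  have hc : ∀ t ∈ modifications x.1, ccnt (Function.update x.1 t.1 t.2) y.1 = ccnt x.1 y.1 := by
    intro t ht
    obtain ⟨h0, h1, -⟩ := (mem_modifications _ _).1 ht
    exact ccnt_update _ _ _ _ h0 h1
  rw [Finset.sum_congr rfl fun t ht => by rw [hc t ht]]
  by_cases hC : (ccnt x.1 y.1 : ℤ) = (k : ℤ) - j
  · simp only [hC, and_true]
    rw [sum_ecnt_modifications (by omega) x y fun e => if e = (k : ℤ) - i - j then 1 else 0]
    have hCq : (ccnt x.1 y.1 : ℚ) = (k : ℚ) - j := by exact_mod_cast hC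
    rw [hCq]
    by_cases h1 : (ecnt x.1 y.1 : ℤ) = (k : ℤ) - (i - 1) - j
    · have hq : (ecnt x.1 y.1 : ℚ) = (k : ℚ) - (i - 1) - j := by exact_mod_cast h1
      rw [hq, if_pos (by omega), if_neg (by omega), if_neg (by omega), if_pos h1,
        if_neg (by omega)]
      ring
    by_cases h2 : (ecnt x.1 y.1 : ℤ) = (k : ℤ) - i - j
    · have hq : (ecnt x.1 y.1 : ℚ) = (k : ℚ) - i - j := by exact_mod_cast h2
      rw [hq, if_neg (by omega), if_pos h2, if_neg (by omega), if_neg h1, if_neg (by omega)]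
      ring
    by_cases h3 : (ecnt x.1 y.1 : ℤ) = (k : ℤ) - (i + 1) - j
    · have hq : (ecnt x.1 y.1 : ℚ) = (k : ℚ) - (i + 1) - j := by exact_mod_cast h3
      rw [hq, if_neg (by omega), if_neg h2, if_pos (by omega), if_neg h1, if_pos h3]
      ring
    · rw [if_neg (by omega), if_neg h2, if_neg (by omega), if_neg h1, if_neg h3]
      ring
  · simp [hC]
end

section
/- In the subconstituent algebra of the non-binary Johnson scheme J_r(k,n), the dual adjacency matrix A*_{01} commutes with the adjacency matrix A_{10}: [A*_{01}, A_{10}] = 0. -/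
/-- `θ*(a, b) = (n/k)((r-2)(k-b) - a(r-1))`. -/
noncomputable def thetaStar (r n k : ℕ) (a b : ℚ) : ℚ :=
  ((n : ℚ) / k) * (((r : ℚ) - 2) * ((k : ℚ) - b) - a * ((r : ℚ) - 1))

/-- `μ*(a, b) = (n-1)(1 - n b / (k(n-k)))`. -/
noncomputable def muStar (n k : ℕ) (b : ℚ) : ℚ :=
  ((n : ℚ) - 1) * (1 - (n : ℚ) * b / ((k : ℚ) * ((n : ℚ) - k)))

/-- Dual adjacency matrix `A*_{10}` of the non-binary Johnson scheme with respect to `x0`. -/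
noncomputable def Astar10 (r n k : ℕ) (x0 : JohnsonVertex r n k) :
    Matrix (JohnsonVertex r n k) (JohnsonVertex r n k) ℚ :=
  Matrix.diagonal fun y =>
    thetaStar r n k ((ccnt x0.1 y.1 : ℚ) - (ecnt x0.1 y.1 : ℚ)) ((k : ℚ) - (ccnt x0.1 y.1 : ℚ))

/-- Dual adjacency matrix `A*_{01}` of the non-binary Johnson scheme with respect to `x0`. -/
noncomputable def Astar01 (r n k : ℕ) (x0 : JohnsonVertex r n k) :
    Matrix (JohnsonVertex r n k) (JohnsonVertex r n k) ℚ :=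
  Matrix.diagonal fun y => muStar n k ((k : ℚ) - (ccnt x0.1 y.1 : ℚ))

/-- Matrix commutator. -/
def mcomm {m : Type*} [Fintype m] (A B : Matrix m m ℚ) : Matrix m m ℚ := A * B - B * A

/-- Two words of weight `k` with `k` common nonzeros have the same support. -/
theorem val_ne_zero_iff_of_ccnt_eq {r n k : ℕ} {x y : JohnsonVertex r n k}
    (h : ccnt x.1 y.1 = k) (i : Fin n) : (x.1 i).val ≠ 0 ↔ (y.1 i).val ≠ 0 := by
  have hx : (Finset.univ.filter fun i => (x.1 i).val ≠ 0 ∧ (y.1 i).val ≠ 0) =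
      Finset.univ.filter fun i => (x.1 i).val ≠ 0 :=
    Finset.eq_of_subset_of_card_le (Finset.monotone_filter_right _ fun _ _ hi => hi.1)
      (x.2.trans h.symm).le
  have hy : (Finset.univ.filter fun i => (x.1 i).val ≠ 0 ∧ (y.1 i).val ≠ 0) =
      Finset.univ.filter fun i => (y.1 i).val ≠ 0 :=
    Finset.eq_of_subset_of_card_le (Finset.monotone_filter_right _ fun _ _ hi => hi.2)
      (y.2.trans h.symm).le
  simpa using Finset.ext_iff.mp (hx.symm.trans hy) i

/-- The number of common nonzeros with `z` depends only on the support. -/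
theorem ccnt_eq_of_ccnt_eq {r n k : ℕ} {x y : JohnsonVertex r n k}
    (h : ccnt x.1 y.1 = k) (z : Fin n → Fin r) : ccnt z x.1 = ccnt z y.1 := by
  simp only [ccnt, val_ne_zero_iff_of_ccnt_eq h]

/-- In the subconstituent algebra of the non-binary Johnson scheme,
`A*_{01}` commutes with `A_{10}`. -/
theorem johnson_Astar01_commutes_A10 (r n k : ℕ) (hr : 3 ≤ r) (hk1 : 1 ≤ k) (hkn : k + 1 ≤ n)
    (x0 : JohnsonVertex r n k) :
    mcomm (Astar01 r n k x0) (Amat r n k 1 0) = 0 := by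
  ext x y
  rw [mcomm, Astar01, Matrix.sub_apply, Matrix.diagonal_mul, Matrix.mul_diagonal,
    Matrix.zero_apply]
  by_cases h : ccnt x.1 y.1 = k
  · rw [ccnt_eq_of_ccnt_eq h]
    ring
  · have hA : Amat r n k 1 0 x y = 0 := by
      simp [Amat, h]
    rw [hA]
    ring
end

section
/- For the non-binary Johnson scheme J_r(k,n) with n ≥ 2k−1, the pair (A_{10}, A*_{10}) satisfies the Dolan–Grady relation [A_{10}, [A_{10}, [A_{10}, A*_{10}]]] = (r−1)²·[A_{10}, A*_{10}]. -/
/-- The matrix of the relation that both letters at `i` are nonzero and all other letters agree. -/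
def letterMatrix (r n k : ℕ) (i : Fin n) :
    Matrix (JohnsonVertex r n k) (JohnsonVertex r n k) ℚ :=
  Matrix.of fun x y =>
    if (∀ j, j ≠ i → x.1 j = y.1 j) ∧ (x.1 i).val ≠ 0 ∧ (y.1 i).val ≠ 0 then 1 else 0

/-- The contribution of the coordinate `i` to the dual adjacency matrix `A*_{10}`. -/
noncomputable def dualLetterMatrix (r n k : ℕ) (x0 : JohnsonVertex r n k) (i : Fin n) :
    Matrix (JohnsonVertex r n k) (JohnsonVertex r n k) ℚ :=
  Matrix.diagonal fun y => ((n : ℚ) / k) *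
    (((r : ℚ) - 1) * (if x0.1 i = y.1 i ∧ (x0.1 i).val ≠ 0 then 1 else 0)
      - (if (x0.1 i).val ≠ 0 ∧ (y.1 i).val ≠ 0 then 1 else 0))

theorem Astar10_eq_sum (r n k : ℕ) (x0 : JohnsonVertex r n k) :
    Astar10 r n k x0 = ∑ i, dualLetterMatrix r n k x0 i := by
  ext x y
  rw [Matrix.sum_apply]
  by_cases h : x = y
  · subst h
    simp only [Astar10, dualLetterMatrix, Matrix.diagonal_apply_eq, thetaStar, ecnt, ccnt,
      Finset.natCast_card_filter]
    rw [← Finset.mul_sum, Finset.sum_sub_distrib, ← Finset.mul_sum]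
    ring
  · simp [Astar10, dualLetterMatrix, Matrix.diagonal_apply_ne _ h]

/-- Replacing a nonzero letter by a nonzero letter preserves the weight. -/
def JohnsonVertex.replace {r n k : ℕ} (x : JohnsonVertex r n k) (i : Fin n) (a : Fin r)
    (hx : (x.1 i).val ≠ 0) (ha : a.val ≠ 0) : JohnsonVertex r n k :=
  ⟨Function.update x.1 i a, by
    refine (congrArg Finset.card ?_).trans x.2
    ext j
    by_cases h : j = i
    · subst h; simp [hx, ha]
    · simp [h]⟩

theorem letterMatrix_mul_of_ne {r n k : ℕ} {i j : Fin n} (hij : i ≠ j)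
    (x y : JohnsonVertex r n k) :
    (letterMatrix r n k i * letterMatrix r n k j) x y =
      if (∀ l, l ≠ i → l ≠ j → x.1 l = y.1 l) ∧ ((x.1 i).val ≠ 0 ∧ (y.1 i).val ≠ 0) ∧
        ((x.1 j).val ≠ 0 ∧ (y.1 j).val ≠ 0) then 1 else 0 := by
  simp only [Matrix.mul_apply, letterMatrix, Matrix.of_apply, mul_ite, mul_one, mul_zero,
    ← ite_and]
  split_ifs with h
  · obtain ⟨h, ⟨hxi, hyi⟩, hxj, hyj⟩ := h
    rw [Finset.sum_eq_single (x.replace i (y.1 i) hxi hyi)]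
    · rw [if_pos]
      refine ⟨⟨fun l hl => ?_, ?_, hyj⟩, fun l hl => ?_, hxi, ?_⟩ <;>
        simp only [JohnsonVertex.replace, Function.update_apply] <;> grind
    · intro z _ hz
      rw [if_neg]
      rintro ⟨⟨h1, -, -⟩, h2, -, -⟩
      refine hz (Subtype.ext (funext fun l => ?_))
      simp only [JohnsonVertex.replace, Function.update_apply]
      grind
    · simp
  · refine Finset.sum_eq_zero fun z _ => if_neg ?_
    rintro ⟨⟨h1, h2, h3⟩, h4, h5, h6⟩
    refine h ⟨fun l hi hj => (h4 l hi).trans (h1 l hj), ⟨h5, ?_⟩, ?_, h3⟩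
    · rwa [← h1 i hij]
    · rwa [h4 j hij.symm]

theorem letterMatrix_commute (r n k : ℕ) (i j : Fin n) :
    Commute (letterMatrix r n k i) (letterMatrix r n k j) := by
  rcases eq_or_ne i j with rfl | hij
  · exact Commute.refl _
  · ext x y
    rw [letterMatrix_mul_of_ne hij, letterMatrix_mul_of_ne hij.symm]
    congr 1
    grind

theorem card_nonzero_letters {r : ℕ} (hr : 1 ≤ r) :
    ((Finset.univ.filter fun a : Fin r => a.val ≠ 0).card : ℚ) = r - 1 := by
  obtain ⟨m, rfl⟩ := Nat.exists_eq_add_of_le' hr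
  have : (Finset.univ.filter fun a : Fin (m + 1) => a.val ≠ 0) = Finset.univ.erase 0 := by
    ext a
    simp
  rw [this, Finset.card_erase_of_mem (Finset.mem_univ _)]
  simp

theorem letterMatrix_mul_self {r : ℕ} (hr : 1 ≤ r) (n k : ℕ) (i : Fin n) :
    letterMatrix r n k i * letterMatrix r n k i = ((r : ℚ) - 1) • letterMatrix r n k i := by
  ext x y
  simp only [Matrix.mul_apply, letterMatrix, Matrix.of_apply, mul_ite, mul_one, mul_zero,
    ← ite_and, Matrix.smul_apply, smul_eq_mul]
  split_ifs with h
  · rw [← Finset.natCast_card_filter, ← card_nonzero_letters hr, Nat.cast_inj]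
    refine Finset.card_bij' (fun z _ => z.1 i)
      (fun a ha => x.replace i a h.2.1 (Finset.mem_filter.1 ha).2) ?_ ?_ ?_ ?_
    · intro z hz
      simp only [Finset.mem_filter, Finset.mem_univ, true_and] at hz ⊢
      exact hz.2.2.2
    · intro a ha
      simp only [Finset.mem_filter, Finset.mem_univ, true_and] at ha ⊢
      simp only [JohnsonVertex.replace, Function.update_apply]
      grind
    · intro z hz
      simp only [Finset.mem_filter, Finset.mem_univ, true_and] at hz
      refine Subtype.ext (funext fun l => ?_)
      simp only [JohnsonVertex.replace, Function.update_apply]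
      grind
    · intro a ha
      simp [JohnsonVertex.replace]
  · refine Finset.sum_eq_zero fun z _ => if_neg ?_
    rintro ⟨⟨h1, h2, h3⟩, h4, h5, h6⟩
    exact h ⟨fun l hl => (h4 l hl).trans (h1 l hl), h5, h3⟩

theorem letterMatrix_commute_dualLetterMatrix {r n k : ℕ} (x0 : JohnsonVertex r n k)
    {i j : Fin n} (hij : i ≠ j) :
    Commute (letterMatrix r n k i) (dualLetterMatrix r n k x0 j) := by
  ext x y
  simp only [dualLetterMatrix, Matrix.mul_diagonal, Matrix.diagonal_mul, letterMatrix,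
    Matrix.of_apply]
  by_cases h : (∀ l, l ≠ i → x.1 l = y.1 l) ∧ (x.1 i).val ≠ 0 ∧ (y.1 i).val ≠ 0
  · rw [h.1 j hij.symm, mul_comm]
  · simp only [if_neg h, zero_mul, mul_zero]

/-- Distinct vertices with `c(x, y) = k` and `e(x, y) = k - 1` are those which differ by
replacing one nonzero letter by another. -/
theorem ecnt_ccnt_iff {r n k : ℕ} {x y : JohnsonVertex r n k} (hxy : x ≠ y) :
    ((ecnt x.1 y.1 : ℤ) = (k : ℤ) - 1 ∧ (ccnt x.1 y.1 : ℤ) = k) ↔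
      ∃ i, (∀ j, j ≠ i → x.1 j = y.1 j) ∧ (x.1 i).val ≠ 0 ∧ (y.1 i).val ≠ 0 := by
  have hx := x.2
  have hy := y.2
  constructor
  · rintro ⟨he, hc⟩
    have hc : ccnt x.1 y.1 = k := by exact_mod_cast hc
    have hcx : (Finset.univ.filter fun i => (x.1 i).val ≠ 0 ∧ (y.1 i).val ≠ 0) =
        Finset.univ.filter fun i => (x.1 i).val ≠ 0 :=
      Finset.eq_of_subset_of_card_le (Finset.monotone_filter_right _ fun i _ h => h.1)
        (hx.trans hc.symm).le
    have hcy : (Finset.univ.filter fun i => (x.1 i).val ≠ 0 ∧ (y.1 i).val ≠ 0) =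
        Finset.univ.filter fun i => (y.1 i).val ≠ 0 :=
      Finset.eq_of_subset_of_card_le (Finset.monotone_filter_right _ fun i _ h => h.2)
        (hy.trans hc.symm).le
    have hs (i : Fin n) : (x.1 i).val ≠ 0 ↔ (y.1 i).val ≠ 0 := by
      simpa using Finset.ext_iff.1 (hcx.symm.trans hcy) i
    have hcard : ((Finset.univ.filter fun i => (x.1 i).val ≠ 0).filter
        fun i => ¬ x.1 i = y.1 i).card = 1 := by
      have := Finset.card_filter_add_card_filter_not
        (s := Finset.univ.filter fun i => (x.1 i).val ≠ 0) (fun i => x.1 i = y.1 i)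
      have he' : ((Finset.univ.filter fun i => (x.1 i).val ≠ 0).filter
          fun i => x.1 i = y.1 i).card = ecnt x.1 y.1 := by
        rw [Finset.filter_filter, ecnt]
        simp only [and_comm]
      omega
    obtain ⟨i, hi⟩ := Finset.card_eq_one.1 hcard
    have hi' (j : Fin n) : ((x.1 j).val ≠ 0 ∧ ¬ x.1 j = y.1 j) ↔ j = i := by
      simpa using Finset.ext_iff.1 hi j
    refine ⟨i, fun j hj => ?_, ((hi' i).2 rfl).1, (hs i).1 ((hi' i).2 rfl).1⟩
    by_contra hne
    by_cases h0 : (x.1 j).val = 0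
    · have := (hs j).not
      exact hne (Fin.ext (by omega))
    · exact hj ((hi' j).1 ⟨h0, hne⟩)
  · rintro ⟨i, h, hxi, hyi⟩
    have hne : x.1 i ≠ y.1 i := fun hi => hxy (Subtype.ext (funext fun j => by
      by_cases hj : j = i
      · rw [hj, hi]
      · exact h j hj))
    have hc : ccnt x.1 y.1 = k := by
      refine (congrArg Finset.card ?_).trans hx
      ext j
      simp only [Finset.mem_filter, Finset.mem_univ, true_and]
      grind
    have he : (Finset.univ.filter fun j => x.1 j = y.1 j ∧ (x.1 j).val ≠ 0) =
        (Finset.univ.filter fun j => (x.1 j).val ≠ 0).erase i := by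
      ext j
      simp only [Finset.mem_filter, Finset.mem_univ, true_and, Finset.mem_erase]
      grind
    refine ⟨?_, by rw [hc]⟩
    rw [ecnt, he, Finset.card_erase_of_mem (by simpa using hxi), hx]
    have : 0 < k := hx ▸ Finset.card_pos.2 ⟨i, by simpa using hxi⟩
    omega

theorem Amat_one_zero_eq (r n k : ℕ) :
    Amat r n k 1 0 = ∑ i, letterMatrix r n k i - (k : ℚ) • 1 := by
  ext x y
  simp only [Amat, Matrix.sub_apply, Matrix.sum_apply, Matrix.smul_apply, letterMatrix,
    Matrix.of_apply]
  rw [if_neg (by norm_num)]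
  simp only [Matrix.of_apply, sub_zero]
  by_cases hxy : x = y
  · subst hxy
    rw [← Finset.natCast_card_filter]
    simp only [ne_eq, implies_true, true_and, and_self, ecnt_self, Matrix.one_apply_eq,
      smul_eq_mul, mul_one]
    rw [if_neg (by omega), sub_eq_zero.2 (congrArg Nat.cast x.2)]
  · rw [Matrix.one_apply_ne hxy, smul_zero, sub_zero]
    simp only [ecnt_ccnt_iff hxy]
    split_ifs with h
    · obtain ⟨i, hi⟩ := h
      rw [Finset.sum_eq_single i, if_pos hi]
      · intro j _ hji
        refine if_neg fun hj => hxy (Subtype.ext (funext fun l => ?_))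
        by_cases hl : l = i
        · exact hj.1 l (hl ▸ hji.symm)
        · exact hi.1 l hl
      · simp
    · exact (Finset.sum_eq_zero fun i _ => if_neg fun hi => h ⟨i, hi⟩).symm

section Ring

variable {ι R : Type*} [Fintype ι] [Ring R]

theorem lie_sum_sum_of_commute {B X : ι → R} (h : ∀ i j, i ≠ j → Commute (B i) (X j)) :
    ⁅∑ i, B i, ∑ i, X i⁆ = ∑ i, ⁅B i, X i⁆ := by
  rw [Ring.lie_def]
  simp only [Finset.sum_mul_sum]
  rw [Finset.sum_comm (f := fun i j => X i * B j), ← Finset.sum_sub_distrib]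
  refine Finset.sum_congr rfl fun i _ => ?_
  rw [← Finset.sum_sub_distrib, Finset.sum_eq_single i]
  · rw [Ring.lie_def]
  · intro j _ hj
    rw [(h i j hj.symm).eq, sub_self]
  · simp

theorem Commute.lie_right_of_commute {a b c : R} (hb : Commute a b) (hc : Commute a c) :
    Commute a ⁅b, c⁆ := by
  rw [Ring.lie_def]
  exact (hb.mul_right hc).sub_right (hc.mul_right hb)

theorem lie_lie_lie_of_mul_self [Algebra ℚ R] {b : R} {m : ℚ} (hb : b * b = m • b) (d : R) :
    ⁅b, ⁅b, ⁅b, d⁆⁆⁆ = m ^ 2 • ⁅b, d⁆ := by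
  have hb' (z : R) : b * (b * z) = m • (b * z) := by rw [← mul_assoc, hb, smul_mul_assoc]
  simp only [Ring.lie_def, mul_sub, sub_mul, mul_assoc, hb', hb, mul_smul_comm, smul_mul_assoc,
    smul_sub, smul_smul]
  module

/-- A sum of pairwise commuting quasi-idempotents satisfies a Dolan–Grady relation with every
sum of elements attached to the same indices. -/
theorem dolan_grady_sum [Algebra ℚ R] {B D : ι → R} {m : ℚ}
    (hB : ∀ i j, Commute (B i) (B j)) (hBB : ∀ i, B i * B i = m • B i)
    (hD : ∀ i j, i ≠ j → Commute (B i) (D j)) :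
    ⁅∑ i, B i, ⁅∑ i, B i, ⁅∑ i, B i, ∑ i, D i⁆⁆⁆ = m ^ 2 • ⁅∑ i, B i, ∑ i, D i⁆ := by
  have h1 : ∀ i j, i ≠ j → Commute (B i) ⁅B j, D j⁆ := fun i j hij =>
    (hB i j).lie_right_of_commute (hD i j hij)
  have h2 : ∀ i j, i ≠ j → Commute (B i) ⁅B j, ⁅B j, D j⁆⁆ := fun i j hij =>
    (hB i j).lie_right_of_commute (h1 i j hij)
  rw [lie_sum_sum_of_commute hD, lie_sum_sum_of_commute h1, lie_sum_sum_of_commute h2,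
    Finset.smul_sum]
  exact Finset.sum_congr rfl fun i _ => lie_lie_lie_of_mul_self (hBB i) (D i)

end Ring

theorem mcomm_sub_smul_one {m : Type*} [Fintype m] [DecidableEq m] (A B : Matrix m m ℚ) (t : ℚ) :
    mcomm (A - t • 1) B = ⁅A, B⁆ := by
  rw [mcomm, Ring.lie_def, sub_mul, mul_sub, smul_mul_assoc, mul_smul_comm, one_mul, mul_one]
  abel

/-- Dolan–Grady relation for the pair `(A_{10}, A*_{10})` in the subconstituent algebra
of the non-binary Johnson scheme, for `n ≥ 2k - 1`. -/
theorem johnson_dolan_grady (r n k : ℕ) (hr : 3 ≤ r) (hk1 : 1 ≤ k) (hkn : k + 1 ≤ n)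
    (hn2k : 2 * (k : ℤ) - 1 ≤ n) (x0 : JohnsonVertex r n k) :
    mcomm (Amat r n k 1 0) (mcomm (Amat r n k 1 0)
        (mcomm (Amat r n k 1 0) (Astar10 r n k x0)))
  = (((r : ℚ) - 1) ^ 2) • mcomm (Amat r n k 1 0) (Astar10 r n k x0) := by
  simp only [Amat_one_zero_eq, mcomm_sub_smul_one, Astar10_eq_sum]
  exact dolan_grady_sum (letterMatrix_commute r n k)
    (letterMatrix_mul_self (by omega) n k)
    fun i j hij => letterMatrix_commute_dualLetterMatrix x0 hij
end
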